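/- Let α₁ ∈ (0,1) and λ = 2 + 2α₁. For real θ set φ₀(θ) = λ − 2α₁ cos θ (so φ₀(θ) ≥ 2 with equality only at θ = 0 modulo 2π) and K₀(θ) = (φ₀(θ) + √(φ₀(θ)² − 4))/2. Define J(n,m) = (1/(2π)) ∫_{−π}^{π} ( e^{i n θ}/K₀(θ)^{|m|} − 1 ) / ( K₀(θ) − 1/K₀(θ) ) dθ for (n,m) ∈ ℤ² (the integrand is integrable despite the vanishing of the denominator at θ = 0). Then J(0,0) = 0 and J satisfies the discrete (unscreened, c = 0) Poisson equation with delta source: for every (n,m) ∈ ℤ², α₁·(2J(n,m) − J(n−1,m) − J(n+1,m)) + (2J(n,m) − J(n,m−1) − J(n,m+1)) = δ_{0n}·δ_{0m}; that is, J(n,m) = B₀(n,m) − B₀(0,0) is the normalized LGF of the two-dimensional Poisson equation on a rectangular lattice. -/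

import Mathlib

open MeasureTheory

/-- `K₀(θ) = (φ₀(θ) + √(φ₀(θ)² − 4))/2` with `φ₀(θ) = λ − 2α₁ cos θ` (the `c = 0` case). -/
noncomputable def K0 (α₁ θ : ℝ) : ℝ :=
  ((2 + 2 * α₁ - 2 * α₁ * Real.cos θ) +
    Real.sqrt ((2 + 2 * α₁ - 2 * α₁ * Real.cos θ) ^ 2 - 4)) / 2

/-- The normalized LGF of the 2D (unscreened) Poisson equation:
`J(n,m) = (1/2π) ∫_{−π}^{π} (e^{inθ}/K₀^{|m|} − 1)/(K₀ − 1/K₀) dθ`. -/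
noncomputable def J (α₁ : ℝ) (n m : ℤ) : ℂ :=
  (1 / (2 * Real.pi) : ℂ) *
    ∫ θ : ℝ in (-Real.pi)..Real.pi,
      (Complex.exp (Complex.I * (n : ℂ) * (θ : ℂ)) / ((K0 α₁ θ : ℝ) : ℂ) ^ m.natAbs - 1) /
        ((K0 α₁ θ - 1 / K0 α₁ θ : ℝ) : ℂ)

theorem one_le_K0 {α₁ : ℝ} (hα : 0 ≤ α₁) (θ : ℝ) : 1 ≤ K0 α₁ θ := by
  have h := mul_nonneg hα (sub_nonneg.2 (Real.cos_le_one θ))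
  have hs := Real.sqrt_nonneg ((2 + 2 * α₁ - 2 * α₁ * Real.cos θ) ^ 2 - 4)
  unfold K0
  linarith

theorem K0_sq_add_one {α₁ : ℝ} (hα : 0 ≤ α₁) (θ : ℝ) :
    K0 α₁ θ ^ 2 + 1 = (2 + 2 * α₁ - 2 * α₁ * Real.cos θ) * K0 α₁ θ := by
  have h := mul_nonneg hα (sub_nonneg.2 (Real.cos_le_one θ))
  have hs := Real.sq_sqrt (show 0 ≤ (2 + 2 * α₁ - 2 * α₁ * Real.cos θ) ^ 2 - 4 by nlinarith)
  unfold K0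
  linear_combination hs / 4

theorem K0_sub_inv_sq {α₁ : ℝ} (hα : 0 ≤ α₁) (θ : ℝ) :
    (K0 α₁ θ - 1 / K0 α₁ θ) ^ 2 = (2 + 2 * α₁ - 2 * α₁ * Real.cos θ) ^ 2 - 4 := by
  have hK : K0 α₁ θ ≠ 0 := (zero_lt_one.trans_le (one_le_K0 hα θ)).ne'
  have h : 2 + 2 * α₁ - 2 * α₁ * Real.cos θ = K0 α₁ θ + 1 / K0 α₁ θ := by
    field_simp
    linarith [K0_sq_add_one hα θ]
  rw [h]
  field_simp
  ring

theorem K0_sub_inv_nonneg {α₁ : ℝ} (hα : 0 ≤ α₁) (θ : ℝ) : 0 ≤ K0 α₁ θ - 1 / K0 α₁ θ := by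
  have hK := one_le_K0 hα θ
  have : 1 / K0 α₁ θ ≤ 1 := (div_le_one (by linarith)).2 hK
  linarith

theorem K0_sub_inv_ne_zero {α₁ θ : ℝ} (hα : 0 < α₁) (hθ : Real.cos θ ≠ 1) :
    K0 α₁ θ - 1 / K0 α₁ θ ≠ 0 := by
  intro h
  have h1 := K0_sub_inv_sq hα.le θ
  have h2 := mul_pos hα (sub_pos.2 (lt_of_le_of_ne (Real.cos_le_one θ) hθ))
  rw [h] at h1
  nlinarith

theorem continuous_K0 (α₁ : ℝ) : Continuous (K0 α₁) := by
  unfold K0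
  fun_prop

/-- The integrand defining `J`. -/
noncomputable def greenIntegrand (α₁ : ℝ) (n m : ℤ) (θ : ℝ) : ℂ :=
  (Complex.exp (Complex.I * (n : ℂ) * (θ : ℂ)) / ((K0 α₁ θ : ℝ) : ℂ) ^ m.natAbs - 1) /
    ((K0 α₁ θ - 1 / K0 α₁ θ : ℝ) : ℂ)

theorem norm_exp_I_mul_sub_one_sq (θ : ℝ) :
    ‖Complex.exp (Complex.I * θ) - 1‖ ^ 2 = 2 * (1 - Real.cos θ) := by
  rw [mul_comm, Complex.exp_mul_I, ← Complex.ofReal_cos, ← Complex.ofReal_sin, Complex.sq_norm,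
    Complex.normSq_apply]
  simp [-Complex.ofReal_cos, -Complex.ofReal_sin]
  linarith [Real.sin_sq_add_cos_sq θ]

theorem norm_exp_I_mul_int_sub_one_le (n : ℤ) (θ : ℝ) :
    ‖Complex.exp (Complex.I * n * θ) - 1‖ ≤ n.natAbs * ‖Complex.exp (Complex.I * θ) - 1‖ := by
  have key : ∀ (k : ℕ) (t : ℝ), ‖Complex.exp (Complex.I * k * t) - 1‖ ≤
      k * ‖Complex.exp (Complex.I * t) - 1‖ := by
    intro k t
    induction k with
    | zero => simp
    | succ k ih =>
      have h : Complex.exp (Complex.I * (k + 1 : ℕ) * t) - 1 =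
          Complex.exp (Complex.I * k * t) * (Complex.exp (Complex.I * t) - 1) +
            (Complex.exp (Complex.I * k * t) - 1) := by
        rw [mul_sub, ← Complex.exp_add]
        push_cast
        ring_nf
      have h1 : ‖Complex.exp (Complex.I * k * t)‖ = 1 := by
        rw [show Complex.I * k * t = Complex.I * ((k * t : ℝ) : ℂ) by push_cast; ring]
        exact Complex.norm_exp_I_mul_ofReal _
      rw [h]
      refine (norm_add_le _ _).trans ?_
      rw [norm_mul, h1]
      push_cast
      linarith
  obtain hn | hn := Int.natAbs_eq n
  · have := key n.natAbs θ
    rwa [show ((n.natAbs : ℕ) : ℂ) = (n : ℂ) by rw [hn]; simp] at this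
  · have h := key n.natAbs (-θ)
    have hsq : ‖Complex.exp (Complex.I * ((-θ : ℝ) : ℂ)) - 1‖ =
        ‖Complex.exp (Complex.I * θ) - 1‖ := by
      rw [← sq_eq_sq₀ (norm_nonneg _) (norm_nonneg _), norm_exp_I_mul_sub_one_sq,
        norm_exp_I_mul_sub_one_sq, Real.cos_neg]
    have hc : (n : ℂ) = -((n.natAbs : ℕ) : ℂ) := by
      conv_lhs => rw [hn]
      simp
    rw [hsq] at h
    convert h using 4
    rw [hc]
    push_cast
    ring

theorem norm_greenIntegrand_le {α₁ : ℝ} (hα : 0 < α₁) (n m : ℤ) (θ : ℝ) :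
    ‖greenIntegrand α₁ n m θ‖ ≤ n.natAbs / Real.sqrt α₁ + m.natAbs := by
  have hK := one_le_K0 hα.le θ
  have hK0 : 0 < K0 α₁ θ := by linarith
  have hD := K0_sub_inv_nonneg hα.le θ
  have hD2 := K0_sub_inv_sq hα.le θ
  have hcos := Real.cos_le_one θ
  have hs : 0 < Real.sqrt α₁ := Real.sqrt_pos.2 hα
  unfold greenIntegrand
  rw [norm_div, Complex.norm_real, Real.norm_of_nonneg hD]
  refine div_le_of_le_mul₀ hD (by positivity) ?_
  have hchord : ‖Complex.exp (Complex.I * θ) - 1‖ ≤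
      (K0 α₁ θ - 1 / K0 α₁ θ) / Real.sqrt α₁ := by
    rw [← sq_le_sq₀ (norm_nonneg _) (by positivity), norm_exp_I_mul_sub_one_sq, div_pow, hD2,
      Real.sq_sqrt hα.le, le_div_iff₀ hα]
    nlinarith [mul_nonneg hα.le (sub_nonneg.2 hcos)]
  have hinv : 0 < (K0 α₁ θ)⁻¹ := inv_pos.2 hK0
  have hinv1 : (K0 α₁ θ)⁻¹ ≤ 1 := inv_le_one_of_one_le₀ hK
  have hpow1 : (K0 α₁ θ)⁻¹ ^ m.natAbs ≤ 1 := pow_le_one₀ hinv.le hinv1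
  have hpow : ‖((((K0 α₁ θ)⁻¹ ^ m.natAbs - 1 : ℝ)) : ℂ)‖ ≤
      m.natAbs * (K0 α₁ θ - 1 / K0 α₁ θ) := by
    have hb := one_add_mul_le_pow (a := (K0 α₁ θ)⁻¹ - 1) (by linarith) m.natAbs
    rw [add_sub_cancel] at hb
    rw [Complex.norm_real, Real.norm_eq_abs, abs_of_nonpos (by linarith), one_div]
    nlinarith [mul_nonneg (Nat.cast_nonneg (α := ℝ) m.natAbs) (sub_nonneg.2 hK)]
  have hsplit : Complex.exp (Complex.I * n * θ) / ((K0 α₁ θ : ℝ) : ℂ) ^ m.natAbs - 1 =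
      (((K0 α₁ θ)⁻¹ ^ m.natAbs : ℝ) : ℂ) * (Complex.exp (Complex.I * n * θ) - 1) +
        (((K0 α₁ θ)⁻¹ ^ m.natAbs - 1 : ℝ) : ℂ) := by
    push_cast
    rw [inv_pow, div_eq_mul_inv]
    ring
  rw [hsplit]
  refine (norm_add_le _ _).trans ?_
  rw [norm_mul, Complex.norm_real, Real.norm_of_nonneg (by positivity), add_mul]
  refine add_le_add ?_ hpow
  calc (K0 α₁ θ)⁻¹ ^ m.natAbs * ‖Complex.exp (Complex.I * n * θ) - 1‖
      ≤ ‖Complex.exp (Complex.I * n * θ) - 1‖ := mul_le_of_le_one_left (norm_nonneg _) hpow1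
    _ ≤ n.natAbs * ‖Complex.exp (Complex.I * θ) - 1‖ := norm_exp_I_mul_int_sub_one_le n θ
    _ ≤ n.natAbs * ((K0 α₁ θ - 1 / K0 α₁ θ) / Real.sqrt α₁) := by gcongr
    _ = n.natAbs / Real.sqrt α₁ * (K0 α₁ θ - 1 / K0 α₁ θ) := by ring

theorem intervalIntegrable_greenIntegrand {α₁ : ℝ} (hα : 0 < α₁) (n m : ℤ) (a b : ℝ) :
    IntervalIntegrable (greenIntegrand α₁ n m) volume a b := by
  have hK : Measurable (K0 α₁) := (continuous_K0 α₁).measurable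
  have hmeas : Measurable (greenIntegrand α₁ n m) := by
    unfold greenIntegrand
    fun_prop
  exact (intervalIntegrable_const (c := n.natAbs / Real.sqrt α₁ + m.natAbs)).mono_fun
    hmeas.aestronglyMeasurable
    (Filter.Eventually.of_forall fun θ =>
      (norm_greenIntegrand_le hα n m θ).trans (Real.le_norm_self _))

theorem greenIntegrand_stencil {α₁ θ : ℝ} (hα : 0 < α₁) (hθ : Real.cos θ ≠ 1) (n m : ℤ) :
    (α₁ : ℂ) * (2 * greenIntegrand α₁ n m θ - greenIntegrand α₁ (n - 1) m θ -
        greenIntegrand α₁ (n + 1) m θ) +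
      (2 * greenIntegrand α₁ n m θ - greenIntegrand α₁ n (m - 1) θ -
        greenIntegrand α₁ n (m + 1) θ) =
      if m = 0 then Complex.exp (Complex.I * n * θ) else 0 := by
  have hK : ((K0 α₁ θ : ℝ) : ℂ) ≠ 0 :=
    Complex.ofReal_ne_zero.2 (zero_lt_one.trans_le (one_le_K0 hα.le θ)).ne'
  have hD : ((K0 α₁ θ : ℝ) : ℂ) - 1 / ((K0 α₁ θ : ℝ) : ℂ) ≠ 0 := by
    exact_mod_cast K0_sub_inv_ne_zero hα hθ
  have hD' : ((K0 α₁ θ : ℝ) : ℂ) ^ 2 - 1 ≠ 0 := by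
    contrapose! hD
    field_simp
    rw [hD, mul_zero]
  have hquad : ((K0 α₁ θ : ℝ) : ℂ) ^ 2 + 1 =
      (2 + 2 * α₁ - 2 * α₁ * Complex.cos θ) * ((K0 α₁ θ : ℝ) : ℂ) := by
    exact_mod_cast K0_sq_add_one hα.le θ
  have hcos : 2 * Complex.cos θ = Complex.exp (Complex.I * θ) + Complex.exp (-(Complex.I * θ)) := by
    rw [Complex.two_cos, mul_comm Complex.I, neg_mul]
  have hp : Complex.exp (Complex.I * ((n + 1 : ℤ) : ℂ) * θ) =
      Complex.exp (Complex.I * n * θ) * Complex.exp (Complex.I * θ) := by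
    rw [← Complex.exp_add]
    push_cast
    ring_nf
  have hm : Complex.exp (Complex.I * ((n - 1 : ℤ) : ℂ) * θ) =
      Complex.exp (Complex.I * n * θ) * Complex.exp (-(Complex.I * θ)) := by
    rw [← Complex.exp_add]
    push_cast
    ring_nf
  have hquad' : ((K0 α₁ θ : ℝ) : ℂ) ^ 2 + 1 =
      (2 + 2 * α₁ - α₁ * (Complex.exp (Complex.I * θ) + Complex.exp (-(Complex.I * θ)))) *
        ((K0 α₁ θ : ℝ) : ℂ) := by
    rw [hquad, ← hcos]
    ring
  unfold greenIntegrand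
  rw [hp, hm]
  push_cast
  generalize Complex.exp (Complex.I * n * θ) = e at *
  generalize Complex.exp (Complex.I * θ) = z at *
  generalize Complex.exp (-(Complex.I * θ)) = w at *
  generalize ((K0 α₁ θ : ℝ) : ℂ) = K at *
  split_ifs with h0
  · subst h0
    norm_num
    field_simp
    linear_combination (-e) * hquad'
  · obtain ⟨k, rfl | rfl⟩ : ∃ k : ℕ, m = k + 1 ∨ m = -(k + 1) := by
      refine ⟨m.natAbs - 1, ?_⟩
      omega
    · rw [show ((k : ℤ) + 1).natAbs = k + 1 by omega, show ((k : ℤ) + 1 - 1).natAbs = k by omega,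
        show ((k : ℤ) + 1 + 1).natAbs = k + 2 by omega]
      field_simp
      linear_combination (-e) * K ^ (2 * k + 2) * hquad'
    · rw [show (-((k : ℤ) + 1)).natAbs = k + 1 by omega,
        show (-((k : ℤ) + 1) - 1).natAbs = k + 2 by omega,
        show (-((k : ℤ) + 1) + 1).natAbs = k by omega]
      field_simp
      linear_combination (-e) * K ^ (2 * k + 2) * hquad'

theorem integral_exp_I_mul_int (n : ℤ) :
    ∫ θ : ℝ in (-Real.pi)..Real.pi, Complex.exp (Complex.I * n * θ) =
      if n = 0 then (2 * Real.pi : ℂ) else 0 := by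
  split_ifs with h
  · subst h
    simp
    ring
  · have hc : Complex.I * (n : ℂ) ≠ 0 := mul_ne_zero Complex.I_ne_zero (Int.cast_ne_zero.2 h)
    rw [integral_exp_mul_complex hc, div_eq_zero_iff, sub_eq_zero]
    left
    rw [Complex.exp_eq_exp_iff_exists_int]
    refine ⟨n, ?_⟩
    push_cast
    ring

/-- `J(0,0) = 0` and `J` satisfies the discrete unscreened Poisson equation with a
Kronecker delta source, i.e. it is the normalized LGF `B₀(n,m) − B₀(0,0)`. -/
theorem stmt18 (α₁ : ℝ) (hα : α₁ ∈ Set.Ioo (0 : ℝ) 1) :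
    J α₁ 0 0 = 0 ∧
      ∀ n m : ℤ,
        (α₁ : ℂ) * (2 * J α₁ n m - J α₁ (n - 1) m - J α₁ (n + 1) m) +
            (2 * J α₁ n m - J α₁ n (m - 1) - J α₁ n (m + 1))
          = if n = 0 ∧ m = 0 then 1 else 0 := by
  have hα0 : 0 < α₁ := hα.1
  refine ⟨by simp [J], fun n m => ?_⟩
  have hJ : ∀ n m : ℤ, J α₁ n m = (1 / (2 * Real.pi) : ℂ) *
      ∫ θ : ℝ in (-Real.pi)..Real.pi, greenIntegrand α₁ n m θ := fun _ _ => rfl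
  have hI : ∀ n m : ℤ, IntervalIntegrable (greenIntegrand α₁ n m) volume (-Real.pi) Real.pi :=
    fun n m => intervalIntegrable_greenIntegrand hα0 n m _ _
  have hπ : (Real.pi : ℂ) ≠ 0 := Complex.ofReal_ne_zero.2 Real.pi_ne_zero
  have hae : ∀ᵐ θ : ℝ, θ ∈ Set.uIoc (-Real.pi) Real.pi →
      (α₁ : ℂ) * (2 * greenIntegrand α₁ n m θ - greenIntegrand α₁ (n - 1) m θ -
          greenIntegrand α₁ (n + 1) m θ) +
        (2 * greenIntegrand α₁ n m θ - greenIntegrand α₁ n (m - 1) θ -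
          greenIntegrand α₁ n (m + 1) θ) =
        if m = 0 then Complex.exp (Complex.I * n * θ) else 0 := by
    filter_upwards [Measure.ae_ne volume (0 : ℝ)] with θ hθ hmem
    rw [Set.uIoc_of_le (by linarith [Real.pi_pos])] at hmem
    refine greenIntegrand_stencil hα0 (fun h => hθ ?_) n m
    exact (Real.cos_eq_one_iff_of_lt_of_lt (by linarith [hmem.1, Real.pi_pos])
      (by linarith [hmem.2, Real.pi_pos])).1 h
  have hint := intervalIntegral.integral_congr_ae hae
  rw [intervalIntegral.integral_add
      (((((hI n m).const_mul 2).sub (hI (n - 1) m)).sub (hI (n + 1) m)).const_mul _)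
      ((((hI n m).const_mul 2).sub (hI n (m - 1))).sub (hI n (m + 1))),
    intervalIntegral.integral_const_mul,
    intervalIntegral.integral_sub (((hI n m).const_mul 2).sub (hI (n - 1) m)) (hI (n + 1) m),
    intervalIntegral.integral_sub ((hI n m).const_mul 2) (hI (n - 1) m),
    intervalIntegral.integral_sub (((hI n m).const_mul 2).sub (hI n (m - 1))) (hI n (m + 1)),
    intervalIntegral.integral_sub ((hI n m).const_mul 2) (hI n (m - 1)),
    intervalIntegral.integral_const_mul] at hint
  simp only [hJ]
  have hrhs : (∫ θ : ℝ in (-Real.pi)..Real.pi,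
      if m = 0 then Complex.exp (Complex.I * n * θ) else 0) =
      2 * Real.pi * (if n = 0 ∧ m = 0 then 1 else 0) := by
    by_cases h : m = 0
    · simp [h, integral_exp_I_mul_int]
    · simp [h]
  rw [hrhs] at hint
  have h1 : (1 / (2 * Real.pi) : ℂ) * (2 * Real.pi) = 1 := by field_simp
  linear_combination (1 / (2 * Real.pi) : ℂ) * hint +
    (if n = 0 ∧ m = 0 then (1 : ℂ) else 0) * h1
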